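/- The triangle T2exc with vertices Q1, Q2, Q3 is a solution of the Cramer–Castillon problem for the triangle ABC and its A-excircle: Q1, Q2 and Q3 all lie on the A-excircle (dist(E_A,Q1) = dist(E_A,Q2) = dist(E_A,Q3) = r_A), and the sides pass cyclically through the vertices of ABC, namely C lies on the line through Q1 and Q2, A lies on the line through Q2 and Q3, and B lies on the line through Q3 and Q1. -/

import Mathlib

open EuclideanGeometry

/-- The point with barycentric coordinates `[x : y : z]` with respect to `(A, B, C)`. -/
noncomputable def bary (A B C : EuclideanSpace ℝ (Fin 2)) (x y z : ℝ) :
    EuclideanSpace ℝ (Fin 2) :=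
  (x + y + z)⁻¹ • (x • A + y • B + z • C)

theorem bary_eq_add {A B C : EuclideanSpace ℝ (Fin 2)} {x y z : ℝ} (h : x + y + z ≠ 0) :
    bary A B C x y z =
      A + ((y / (x + y + z)) • (B - A) + (z / (x + y + z)) • (C - A)) := by
  ext i
  simp only [bary, PiLp.smul_apply, PiLp.add_apply, PiLp.sub_apply, smul_eq_mul]
  field_simp
  ring

theorem norm_smul_sub_add_smul_sub_sq (A B C : EuclideanSpace ℝ (Fin 2)) (β γ : ℝ) :
    ‖β • (B - A) + γ • (C - A)‖ ^ 2 = β ^ 2 * dist A B ^ 2 + γ ^ 2 * dist C A ^ 2 +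
      β * γ * (dist C A ^ 2 + dist A B ^ 2 - dist B C ^ 2) := by
  have h := norm_sub_sq_real (B - A) (C - A)
  rw [sub_sub_sub_cancel_right] at h
  rw [norm_add_sq_real, norm_smul, norm_smul, mul_pow, mul_pow, inner_smul_left,
    inner_smul_right, dist_comm A B, dist_eq_norm, dist_eq_norm, dist_eq_norm, h]
  simp only [Real.norm_eq_abs, sq_abs, conj_trivial]
  ring

/-- The power of a point with respect to the `A`-excircle in barycentric coordinates, where
`u`, `v`, `w` are the differences of the semiperimeter with `b`, `c`, `a`. -/
theorem dist_excenter_bary_sq {A B C : EuclideanSpace ℝ (Fin 2)} {u v w x y z : ℝ}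
    (hw : w ≠ 0) (ha : dist B C = u + v) (hb : dist C A = w + v) (hc : dist A B = w + u)
    (h : x + y + z ≠ 0) :
    dist (bary A B C (-(u + v)) (w + v) (w + u)) (bary A B C x y z) ^ 2 =
      (u + v + w) * u * v / w +
        ((x * (u + v + w) + y * v + z * u) ^ 2 - 4 * (y * v) * (z * u)) / (x + y + z) ^ 2 := by
  have h2 : -(u + v) + (w + v) + (w + u) = 2 * w := by ring
  have h' : -(u + v) + (w + v) + (w + u) ≠ 0 := by rw [h2]; positivity
  have hd : ∀ β γ β' γ' : ℝ,
      A + (β • (B - A) + γ • (C - A)) - (A + (β' • (B - A) + γ' • (C - A))) =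
        (β - β') • (B - A) + (γ - γ') • (C - A) := fun _ _ _ _ => by module
  rw [bary_eq_add h, bary_eq_add h', h2, dist_eq_norm, hd, norm_smul_sub_add_smul_sub_sq,
    ha, hb, hc]
  field_simp
  ring

theorem infDist_excenter {A B C : EuclideanSpace ℝ (Fin 2)} {u v w : ℝ}
    (hu : 0 < u) (hv : 0 < v) (hw : 0 < w)
    (ha : dist B C = u + v) (hb : dist C A = w + v) (hc : dist A B = w + u) :
    Metric.infDist (bary A B C (-(u + v)) (w + v) (w + u))
      (affineSpan ℝ {B, C} : Set (EuclideanSpace ℝ (Fin 2))) =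
        √((u + v + w) * u * v / w) := by
  have hline : ∀ t : ℝ, AffineMap.lineMap B C t = bary A B C 0 (1 - t) t := fun t => by
    simp [bary, AffineMap.lineMap_apply_module]
  have hsq : ∀ t : ℝ, dist (bary A B C (-(u + v)) (w + v) (w + u))
      (AffineMap.lineMap B C t) ^ 2 =
        (u + v + w) * u * v / w + ((1 - t) * v - t * u) ^ 2 := fun t => by
    rw [hline, dist_excenter_bary_sq hw.ne' ha hb hc (by simp)]
    ring
  apply le_antisymm
  · refine (Metric.infDist_le_dist_of_mem
      (AffineMap.lineMap_mem_affineSpan_pair (v / (u + v)) B C)).trans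
        (Real.le_sqrt_of_sq_le ?_)
    rw [hsq]
    apply le_of_eq
    field_simp
    ring
  · refine (Metric.le_infDist ⟨B, left_mem_affineSpan_pair ℝ B C⟩).2 fun P hP => ?_
    obtain ⟨t, rfl⟩ := mem_affineSpan_pair_iff_exists_lineMap_eq.1 hP
    refine Real.sqrt_le_iff.2 ⟨dist_nonneg, ?_⟩
    rw [hsq]
    exact le_add_of_nonneg_right (sq_nonneg _)

theorem dist_lt_dist_add_dist_of_affineIndependent {A B C : EuclideanSpace ℝ (Fin 2)}
    (h : AffineIndependent ℝ ![A, B, C]) : dist A C < dist A B + dist B C :=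
  (dist_triangle A B C).lt_of_ne fun he =>
    affineIndependent_iff_not_collinear_set.1 h (dist_add_dist_eq_iff.1 he.symm).collinear

theorem mem_affineSpan_pair_of_smul_sub_smul_eq {P Q R : EuclideanSpace ℝ (Fin 2)} {k l : ℝ}
    (hkl : k - l ≠ 0) (h : k • P - l • Q = (k - l) • R) :
    R ∈ affineSpan ℝ ({P, Q} : Set (EuclideanSpace ℝ (Fin 2))) := by
  have hR : R = AffineMap.lineMap P Q (-l / (k - l)) := by
    rw [← inv_smul_smul₀ hkl R, ← h, AffineMap.lineMap_apply_module]
    have : 1 - -l / (k - l) = (k - l)⁻¹ * k := by field_simp; ring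
    rw [this]
    module
  rw [hR]
  exact AffineMap.lineMap_mem_affineSpan_pair _ _ _

theorem sum_smul_bary {A B C : EuclideanSpace ℝ (Fin 2)} {x y z : ℝ} (h : x + y + z ≠ 0) :
    (x + y + z) • bary A B C x y z = x • A + y • B + z • C :=
  smul_inv_smul₀ h _

/-- The triangle `T2exc = (Q1, Q2, Q3)` is a solution of the Cramer–Castillon problem for
the triangle `ABC` and its A-excircle: its vertices lie on the A-excircle and its sides
pass cyclically through `C`, `A`, `B`. -/
theorem ccp_a_excircle_second_solution
    (A B C : EuclideanSpace ℝ (Fin 2)) (hABC : AffineIndependent ℝ ![A, B, C])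
    (a b c s φ : ℝ)
    (ha : a = dist B C) (hb : b = dist C A) (hc : c = dist A B)
    (hs : s = (a + b + c) / 2)
    (hφ : φ = (1 + Real.sqrt 5) / 2)
    (EA : EuclideanSpace ℝ (Fin 2)) (hEA : EA = bary A B C (-a) b c)
    (rA : ℝ)
    (hrA : rA = Metric.infDist EA (affineSpan ℝ {B, C} : Set (EuclideanSpace ℝ (Fin 2))))
    (Q1 Q2 Q3 : EuclideanSpace ℝ (Fin 2))
    (hQ1 : Q1 = bary A B C ((b - s) * (s - c) * (φ - 1) ^ 2) (s * (s - b) * (φ - 2) ^ 2)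
      (s * (s - c)))
    (hQ2 : Q2 = bary A B C ((c - s) * (s - b)) (s * (s - b) * (φ - 1) ^ 2)
      (s * (s - c) * (φ - 2) ^ 2))
    (hQ3 : Q3 = bary A B C ((b - s) * (s - c) * (φ - 2) ^ 2) (s * (s - b))
      (s * (s - c) * (φ - 1) ^ 2)) :
    dist EA Q1 = rA ∧ dist EA Q2 = rA ∧ dist EA Q3 = rA ∧
    C ∈ affineSpan ℝ ({Q1, Q2} : Set (EuclideanSpace ℝ (Fin 2))) ∧
    A ∈ affineSpan ℝ ({Q2, Q3} : Set (EuclideanSpace ℝ (Fin 2))) ∧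
    B ∈ affineSpan ℝ ({Q3, Q1} : Set (EuclideanSpace ℝ (Fin 2))) := by
  obtain ⟨u, hu⟩ : ∃ u, u = s - b := ⟨_, rfl⟩
  obtain ⟨v, hv⟩ : ∃ v, v = s - c := ⟨_, rfl⟩
  obtain ⟨w, hw⟩ : ∃ w, w = s - a := ⟨_, rfl⟩
  have hBCA : AffineIndependent ℝ ![B, C, A] := by
    rw [affineIndependent_iff_not_collinear_set] at hABC ⊢
    rwa [Set.insert_comm, Set.pair_comm] at hABC
  have hCAB : AffineIndependent ℝ ![C, A, B] := by
    rw [affineIndependent_iff_not_collinear_set] at hABC ⊢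
    rwa [Set.insert_comm, Set.pair_comm, Set.insert_comm, Set.pair_comm] at hABC
  have hu0 : 0 < u := by
    have := dist_lt_dist_add_dist_of_affineIndependent hABC
    rw [dist_comm A C] at this
    linarith
  have hv0 : 0 < v := by
    have := dist_lt_dist_add_dist_of_affineIndependent hBCA
    rw [dist_comm B A] at this
    linarith
  have hw0 : 0 < w := by
    have := dist_lt_dist_add_dist_of_affineIndependent hCAB
    rw [dist_comm C B] at this
    linarith
  have hs' : s = u + v + w := by linarith
  have ha' : a = u + v := by linarith
  have hb' : b = w + v := by linarith
  have hc' : c = w + u := by linarith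
  have hφ2 : φ ^ 2 = φ + 1 := by rw [hφ]; exact Real.goldenRatio_sq
  have hφ1 : 1 < φ := by rw [hφ]; exact Real.one_lt_goldenRatio
  have hφ3 : φ < 2 := by rw [hφ]; exact Real.goldenRatio_lt_two
  obtain ⟨q, hq⟩ : ∃ q, q = 2 - φ := ⟨_, rfl⟩
  have hq0 : 0 < q := by linarith
  have hq1 : q < 1 := by linarith
  have hqq : q ^ 2 = 3 * q - 1 := by rw [hq]; linear_combination hφ2
  have h1 : (φ - 1) ^ 2 = q := by rw [hq]; linear_combination hφ2
  have h2 : (φ - 2) ^ 2 = q ^ 2 := by rw [hq]; ring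
  have hbs : b - s = -u := by linarith
  have hcs : c - s = -v := by linarith
  rw [h1, h2, hbs, ← hu, ← hv, hs'] at hQ1 hQ3
  rw [h1, h2, hcs, ← hu, ← hv, hs'] at hQ2
  rw [ha', hb', hc'] at hEA
  have hdA := ha.symm.trans ha'
  have hdB := hb.symm.trans hb'
  have hdC := hc.symm.trans hc'
  have n1 : -u * v * q + (u + v + w) * u * q ^ 2 + (u + v + w) * v ≠ 0 := by
    have : 0 < (u + v) * u * q ^ 2 + w * u * q ^ 2 + v ^ 2 + w * v + u * v * (1 - q) := by
      have := sub_pos.2 hq1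
      positivity
    exact (this.trans_eq (by ring)).ne'
  have n2 : -v * u + (u + v + w) * u * q + (u + v + w) * v * q ^ 2 ≠ 0 := by
    have : 0 < q * (u - (1 - q) * v) ^ 2 + (w * u * q + w * v * q ^ 2) := by positivity
    refine (this.trans_eq ?_).ne'
    linear_combination (u * v + q * v ^ 2) * hqq
  have n3 : -u * v * q ^ 2 + (u + v + w) * u + (u + v + w) * v * q ≠ 0 := by
    have : 0 < u ^ 2 + w * u + (u + v + w) * v * q + u * v * (1 - q ^ 2) := by
      have : 0 < 1 - q ^ 2 := by nlinarith
      positivity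
    exact (this.trans_eq (by ring)).ne'
  have hr := infDist_excenter hu0 hv0 hw0 hdA hdB hdC
  rw [← hEA, ← hrA] at hr
  have hdist : ∀ {x y z : ℝ}, x + y + z ≠ 0 →
      (x * (u + v + w) + y * v + z * u) ^ 2 - 4 * (y * v) * (z * u) = 0 →
      dist EA (bary A B C x y z) = rA := fun h h0 => by
    rw [hr, hEA, ← Real.sqrt_sq dist_nonneg, dist_excenter_bary_sq hw0.ne' hdA hdB hdC h, h0,
      zero_div, add_zero]
  have hs0 : 0 < u + v + w := by positivity
  have hq3 : 0 < 1 - q ^ 3 := sub_pos.2 (pow_lt_one₀ hq0.le hq1 three_ne_zero)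
  have e1 := sum_smul_bary (A := A) (B := B) (C := C) n1
  have e2 := sum_smul_bary (A := A) (B := B) (C := C) n2
  have e3 := sum_smul_bary (A := A) (B := B) (C := C) n3
  rw [← hQ1] at e1
  rw [← hQ2] at e2
  rw [← hQ3] at e3
  refine ⟨?_, ?_, ?_, ?_, ?_, ?_⟩
  · rw [hQ1]
    refine hdist n1 ?_
    linear_combination ((u + v + w) * u * v) ^ 2 * (q ^ 2 + q + 1) * hqq
  · rw [hQ2]
    refine hdist n2 ?_
    linear_combination ((u + v + w) * u * v) ^ 2 * (q ^ 2 + q + 1) * hqq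
  · rw [hQ3]
    refine hdist n3 ?_
    linear_combination ((u + v + w) * u * v) ^ 2 * (q ^ 2 + q + 1) * hqq
  · have hk : (-u * v * q + (u + v + w) * u * q ^ 2 + (u + v + w) * v) -
        q * (-v * u + (u + v + w) * u * q + (u + v + w) * v * q ^ 2) =
          (u + v + w) * v * (1 - q ^ 3) := by ring
    refine mem_affineSpan_pair_of_smul_sub_smul_eq (hk.trans_ne (by positivity)) ?_
    rw [hk, mul_smul, e1, e2]
    module
  · have hk : (-v * u + (u + v + w) * u * q + (u + v + w) * v * q ^ 2) -
        q * (-u * v * q ^ 2 + (u + v + w) * u + (u + v + w) * v * q) =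
          -(u * v * (1 - q ^ 3)) := by ring
    refine mem_affineSpan_pair_of_smul_sub_smul_eq
      (hk.trans_ne (neg_ne_zero.2 (by positivity))) ?_
    rw [hk, mul_smul, e2, e3]
    module
  · have hk : (-u * v * q ^ 2 + (u + v + w) * u + (u + v + w) * v * q) -
        q * (-u * v * q + (u + v + w) * u * q ^ 2 + (u + v + w) * v) =
          (u + v + w) * u * (1 - q ^ 3) := by ring
    refine mem_affineSpan_pair_of_smul_sub_smul_eq (hk.trans_ne (by positivity)) ?_
    rw [hk, mul_smul, e3, e1]
    module
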